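/- Let M̃ = 2·sup_{z'∈Z} E_{z∼D} β(z',z) + 2η + M_l. Then for any λ ∈ ℝ, E[ exp(2λ·Σ_{k=1}^{m} D_k^{(1)}) ] ≤ exp((1/2) m λ² M̃²). -/

import Mathlib

open MeasureTheory

noncomputable section

variable {d : ℕ}

/-- The σ-field `F_k` generated by the first `k` coordinates `z_1, …, z_k` of the sample. -/
def coordSigma (Z : Set (EuclideanSpace ℝ (Fin d))) (m k : ℕ) :
    MeasurableSpace (Fin m → Z) :=
  ⨆ i ∈ {i : Fin m | (i : ℕ) < k}, MeasurableSpace.comap (fun ω => ω i) inferInstance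

/-- The event `E_{-k}`: the leave-`k`-out empirical average of `β(z',·)` is uniformly
(over `z' ∈ Z`) within `η` of its population mean. -/
def goodEvent {Z : Set (EuclideanSpace ℝ (Fin d))} (β : Z → Z → ℝ) (D : Measure Z)
    (η : ℝ) {m : ℕ} (k : Fin m) : Set (Fin m → Z) :=
  {ω | ∀ z' : Z, |(∑ j ∈ Finset.univ.erase k, β z' (ω j)) / m - ∫ z, β z' z ∂D| ≤ η}

/-- `L(S) = ∑_{j=1}^m l(A_S, z_j)`. -/
def totalLoss {Z : Set (EuclideanSpace ℝ (Fin d))} {F : Type*} (l : F → Z → ℝ)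
    (A : (n : ℕ) → (Fin n → Z) → F) (m : ℕ) (ω : Fin m → Z) : ℝ :=
  ∑ j, l (A m ω) (ω j)


/-- `D_k^{(1)} = E[L(S)·1_{E_{-k}} | F_k] − E[L(S)·1_{E_{-k}} | F_{k−1}]`; here the
`0`-indexed `k : Fin m` corresponds to the paper's `k + 1 ∈ {1,…,m}`. -/
def Done {Z : Set (EuclideanSpace ℝ (Fin d))} {F : Type*} (l : F → Z → ℝ)
    (A : (n : ℕ) → (Fin n → Z) → F) (β : Z → Z → ℝ) (D : Measure Z) (η : ℝ) {m : ℕ}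
    (μ : Measure (Fin m → Z)) (k : Fin m) : (Fin m → Z) → ℝ :=
  (μ[fun ω => totalLoss l A m ω *
      (goodEvent β D η k).indicator (fun _ => (1 : ℝ)) ω | coordSigma Z m ((k : ℕ) + 1)])
  - (μ[fun ω => totalLoss l A m ω *
      (goodEvent β D η k).indicator (fun _ => (1 : ℝ)) ω | coordSigma Z m (k : ℕ)])

section Aux

open ProbabilityTheory

/-- Hoeffding's lemma, where the range of `X` is controlled through almost every pair of values. -/
lemma integral_exp_mul_le_of_sub_le {Ω : Type*} [MeasurableSpace Ω] {ν : Measure Ω}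
    [IsProbabilityMeasure ν] {X : Ω → ℝ} (hX : AEMeasurable X ν) {R c : ℝ}
    (hR : ∀ᵐ x ∂ν, |X x| ≤ R) (h0 : ∫ x, X x ∂ν = 0)
    (hc : ∀ᵐ y ∂ν, ∀ᵐ x ∂ν, X x - X y ≤ c) (t : ℝ) :
    ∫ x, Real.exp (t * X x) ∂ν ≤ Real.exp (t ^ 2 * c ^ 2 / 8) := by
  have hbdd : Filter.IsBoundedUnder (· ≤ ·) (ae ν) X :=
    ⟨R, Filter.eventually_map.2 (hR.mono fun x hx => (abs_le.1 hx).2)⟩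
  have hcobdd : Filter.IsCoboundedUnder (· ≤ ·) (ae ν) X := by
    refine Filter.IsBoundedUnder.isCoboundedUnder_le ⟨-R, ?_⟩
    exact Filter.eventually_map.2 (hR.mono fun x hx => (abs_le.1 hx).1)
  have hIcc : ∀ᵐ x ∂ν, X x ∈ Set.Icc (essSup X ν - c) (essSup X ν) := by
    filter_upwards [ae_le_essSup hbdd, hc] with y hy hxy
    refine ⟨?_, hy⟩
    have : essSup X ν ≤ X y + c := by
      refine essSup_le_of_ae_le _ ?_ hcobdd
      filter_upwards [hxy] with x hx
      linarith
    linarith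
  refine ((hasSubgaussianMGF_of_mem_Icc_of_integral_eq_zero hX hIcc h0).mgf_le t).trans ?_
  refine Real.exp_le_exp.2 (le_of_eq ?_)
  have : ((‖essSup X ν - (essSup X ν - c)‖₊ : NNReal) : ℝ) = |c| := by simp
  push_cast [this]
  rw [div_pow, sq_abs]
  ring

/-- Taking the coordinates in `s` from one sample and the others from an independent copy
produces a sample with the same law. -/
lemma measurePreserving_piecewise {ι α : Type*} [Fintype ι] [MeasurableSpace α] (D : Measure α)
    [IsProbabilityMeasure D] (s : Set ι) [DecidablePred (· ∈ s)] :
    MeasurePreserving (fun p : (ι → α) × (ι → α) => s.piecewise p.1 p.2)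
      ((Measure.pi fun _ => D).prod (Measure.pi fun _ => D)) (Measure.pi fun _ => D) := by
  have hm : Measurable fun p : (ι → α) × (ι → α) => s.piecewise p.1 p.2 := by
    refine measurable_pi_lambda _ fun i => ?_
    by_cases hi : i ∈ s
    · simpa [hi, Function.comp_def] using (measurable_pi_apply i).comp measurable_fst
    · simpa [hi, Function.comp_def] using (measurable_pi_apply i).comp measurable_snd
  refine ⟨hm, (Measure.pi_eq fun t ht => ?_).symm⟩
  rw [Measure.map_apply hm (MeasurableSet.univ_pi ht)]
  have hpre : (fun p : (ι → α) × (ι → α) => s.piecewise p.1 p.2) ⁻¹' Set.univ.pi t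
      = (Set.univ.pi fun i => if i ∈ s then t i else Set.univ) ×ˢ
        (Set.univ.pi fun i => if i ∈ s then Set.univ else t i) := by
    ext p
    simp only [Set.mem_preimage, Set.mem_univ_pi, Set.mem_prod, ← forall_and]
    refine forall_congr' fun i => ?_
    by_cases hi : i ∈ s <;> simp [hi]
  rw [hpre, Measure.prod_prod, Measure.pi_pi, Measure.pi_pi, ← Finset.prod_mul_distrib]
  refine Finset.prod_congr rfl fun i _ => ?_
  by_cases hi : i ∈ s <;> simp [hi]

/-- Resampling a single coordinate preserves the law of an i.i.d. sample. -/
lemma measurePreserving_update {ι α : Type*} [Fintype ι] [DecidableEq ι] [MeasurableSpace α]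
    (D : Measure α) [IsProbabilityMeasure D] (k : ι) :
    MeasurePreserving (fun p : (ι → α) × (ι → α) => Function.update p.1 k (p.2 k))
      ((Measure.pi fun _ => D).prod (Measure.pi fun _ => D)) (Measure.pi fun _ => D) := by
  convert measurePreserving_piecewise D {i | i ≠ k} using 2 with p
  ext i
  by_cases hi : i = k
  · subst hi; simp
  · simp [hi]

variable {Z : Set (EuclideanSpace ℝ (Fin d))} {m : ℕ}

lemma coordSigma_le (k : ℕ) : coordSigma Z m k ≤ MeasurableSpace.pi :=
  iSup₂_le fun i _ => (measurable_pi_apply i).comap_le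

lemma coordSigma_mono {j k : ℕ} (h : j ≤ k) : coordSigma Z m j ≤ coordSigma Z m k :=
  iSup₂_le fun i hi => le_iSup₂_of_le i (lt_of_lt_of_le hi h) le_rfl

/-- `coordSigma Z m k` is generated by the map that freezes the coordinates from `k` on. -/
lemma coordSigma_eq_comap (k : ℕ) (y : Fin m → Z) :
    coordSigma Z m k = MeasurableSpace.comap
      (fun x : Fin m → Z => {i : Fin m | (i : ℕ) < k}.piecewise x y) MeasurableSpace.pi := by
  apply le_antisymm
  · refine iSup₂_le fun i hi => ?_
    rw [← measurable_iff_comap_le]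
    have : (fun x : Fin m → Z => x i) =
        (fun x => x i) ∘ fun x : Fin m → Z => {i : Fin m | (i : ℕ) < k}.piecewise x y := by
      ext1 x
      simp [Set.piecewise_eq_of_mem _ _ _ hi]
    rw [this]
    exact (measurable_pi_apply i).comp (comap_measurable _)
  · rw [← measurable_iff_comap_le]
    refine @measurable_pi_lambda _ _ _ (coordSigma Z m k) _ _ fun i => ?_
    by_cases hi : i ∈ {i : Fin m | (i : ℕ) < k}
    · simp only [Set.piecewise_eq_of_mem _ _ _ hi]
      rw [measurable_iff_comap_le]
      exact le_iSup₂_of_le i hi le_rfl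
    · simp only [Set.piecewise_eq_of_notMem _ _ _ hi]
      exact measurable_const

/-- A `coordSigma Z m k`-measurable function only depends on the first `k` coordinates. -/
lemma eq_of_stronglyMeasurable_coordSigma {k : ℕ} {f : (Fin m → Z) → ℝ}
    (hf : StronglyMeasurable[coordSigma Z m k] f) {x y : Fin m → Z}
    (h : ∀ i : Fin m, (i : ℕ) < k → x i = y i) : f x = f y := by
  rw [coordSigma_eq_comap k x] at hf
  refine hf.factorsThrough (funext fun i => ?_)
  by_cases hi : (i : ℕ) < k <;> simp [Set.piecewise, hi, h]

/-- Conditioning on the first `k` coordinates amounts to integrating out the other ones. -/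
lemma condExp_coordSigma_ae_eq (D : Measure Z) [IsProbabilityMeasure D] (k : ℕ) {f : (Fin m → Z) → ℝ}
    (hf : Integrable f (Measure.pi fun _ => D)) :
    (Measure.pi fun _ => D)[f | coordSigma Z m k] =ᵐ[Measure.pi fun _ => D]
      fun x => ∫ y, f ({i : Fin m | (i : ℕ) < k}.piecewise x y) ∂(Measure.pi fun _ => D) := by
  set μ : Measure (Fin m → Z) := Measure.pi fun _ => D with hμ
  have hmp := measurePreserving_piecewise D {i : Fin m | (i : ℕ) < k}
  have hint := hmp.integrable_comp_of_integrable hf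
  symm
  refine ae_eq_condExp_of_forall_setIntegral_eq (coordSigma_le k) hf
    (fun s _ _ => hint.integral_prod_left.integrableOn) (fun s hs _ => ?_) ?_
  · have hs' := coordSigma_le k s hs
    have hind : ∀ x y : Fin m → Z,
        s.indicator f ({i : Fin m | (i : ℕ) < k}.piecewise x y)
          = s.indicator (fun x => f ({i : Fin m | (i : ℕ) < k}.piecewise x y)) x := by
      intro x y
      have h1 := eq_of_stronglyMeasurable_coordSigma
        (stronglyMeasurable_const.indicator hs : StronglyMeasurable[coordSigma Z m k]
          (s.indicator fun _ => (1 : ℝ)))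
        (x := {i : Fin m | (i : ℕ) < k}.piecewise x y) (y := x)
        (fun i hi => by simp [Set.piecewise, hi])
      by_cases hx : x ∈ s <;>
        by_cases hx' : {i : Fin m | (i : ℕ) < k}.piecewise x y ∈ s <;>
        simp_all [Set.indicator]
    have hint' := hmp.integrable_comp_of_integrable (hf.indicator hs')
    have hmap : ∫ x, s.indicator f x ∂μ
        = ∫ x, ∫ y, s.indicator f ({i : Fin m | (i : ℕ) < k}.piecewise x y) ∂μ ∂μ := by
      conv_lhs => rw [hμ, ← hmp.map_eq]
      rw [integral_map hmp.measurable.aemeasurable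
        (by rw [hmp.map_eq]; exact (hf.indicator hs').aestronglyMeasurable)]
      exact integral_prod _ hint'
    rw [← integral_indicator hs', ← integral_indicator hs', hmap]
    refine integral_congr_ae (ae_of_all _ fun x => ?_)
    simp only [hind]
    by_cases hx : x ∈ s <;> simp [hx]
  · obtain ⟨y₀⟩ : Nonempty (Fin m → Z) := nonempty_of_isProbabilityMeasure μ
    set f' := hf.aestronglyMeasurable.mk f with hf'
    have hf'm : StronglyMeasurable f' := hf.aestronglyMeasurable.stronglyMeasurable_mk
    have hae : ∀ᵐ x ∂μ, ∀ᵐ y ∂μ, f ({i : Fin m | (i : ℕ) < k}.piecewise x y)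
        = f' ({i : Fin m | (i : ℕ) < k}.piecewise x y) :=
      Measure.ae_ae_of_ae_prod
        (hmp.quasiMeasurePreserving.ae hf.aestronglyMeasurable.ae_eq_mk)
    refine ⟨fun x => ∫ y, f' ({i : Fin m | (i : ℕ) < k}.piecewise x y) ∂μ, ?_, ?_⟩
    · have hG : StronglyMeasurable
          fun x => ∫ y, f' ({i : Fin m | (i : ℕ) < k}.piecewise x y) ∂μ :=
        StronglyMeasurable.integral_prod_right
          (f := fun x y => f' ({i : Fin m | (i : ℕ) < k}.piecewise x y))
          (hf'm.comp_measurable hmp.measurable)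
      have hcomp : (fun x => ∫ y, f' ({i : Fin m | (i : ℕ) < k}.piecewise x y) ∂μ)
          = (fun x => ∫ y, f' ({i : Fin m | (i : ℕ) < k}.piecewise x y) ∂μ) ∘
            fun x => {i : Fin m | (i : ℕ) < k}.piecewise x y₀ := by
        ext1 x
        simp only [Function.comp_apply]
        congr! 3 with y
        ext i
        by_cases hi : (i : ℕ) < k <;> simp [Set.piecewise, hi]
      rw [hcomp, coordSigma_eq_comap k y₀]
      exact hG.comp_measurable (comap_measurable _)
    · filter_upwards [hae] with x hx using integral_congr_ae hx

/-- The increment of the Doob martingale of `f` when the coordinate `k` is revealed. -/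
def doobIncrement (D : Measure Z) (f : (Fin m → Z) → ℝ) (k : Fin m) : (Fin m → Z) → ℝ :=
  (Measure.pi fun _ : Fin m => D)[f | coordSigma Z m ((k : ℕ) + 1)]
    - (Measure.pi fun _ : Fin m => D)[f | coordSigma Z m (k : ℕ)]

lemma stronglyMeasurable_doobIncrement (D : Measure Z) (f : (Fin m → Z) → ℝ) (k : Fin m) :
    StronglyMeasurable[coordSigma Z m ((k : ℕ) + 1)] (doobIncrement D f k) :=
  stronglyMeasurable_condExp.sub
    (stronglyMeasurable_condExp.mono (coordSigma_mono (Nat.le_succ _)))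

lemma abs_doobIncrement_le (D : Measure Z) {f : (Fin m → Z) → ℝ} {R : ℝ} (hf : ∀ x, |f x| ≤ R)
    (k : Fin m) : ∀ᵐ x ∂(Measure.pi fun _ => D), |doobIncrement D f k x| ≤ 2 * R := by
  filter_upwards [ae_bdd_abs_condExp_of_ae_bdd_abs (m := coordSigma Z m ((k : ℕ) + 1))
      (ae_of_all (Measure.pi fun _ => D) hf),
    ae_bdd_abs_condExp_of_ae_bdd_abs (m := coordSigma Z m (k : ℕ))
      (ae_of_all (Measure.pi fun _ => D) hf)] with x h1 h2
  simp only [doobIncrement, Pi.sub_apply]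
  exact (abs_sub _ _).trans (by linarith)

lemma condExp_coordSigma_update (D : Measure Z) (f : (Fin m → Z) → ℝ) (k : Fin m) (x : Fin m → Z) (z : Z) :
    ((Measure.pi fun _ => D)[f | coordSigma Z m (k : ℕ)]) (Function.update x k z)
      = ((Measure.pi fun _ => D)[f | coordSigma Z m (k : ℕ)]) x :=
  eq_of_stronglyMeasurable_coordSigma stronglyMeasurable_condExp fun i hi => by
    rw [Function.update_of_ne (by rintro rfl; exact lt_irrefl _ hi)]

lemma integral_doobIncrement_update (D : Measure Z) [IsProbabilityMeasure D]
    (f : (Fin m → Z) → ℝ) (k : Fin m) :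
    ∀ᵐ x ∂(Measure.pi fun _ => D),
      ∫ y, doobIncrement D f k (Function.update x k (y k)) ∂(Measure.pi fun _ => D) = 0 := by
  set μ : Measure (Fin m → Z) := Measure.pi fun _ => D with hμ
  have hint : Integrable (doobIncrement D f k) μ := integrable_condExp.sub integrable_condExp
  have hzero : μ[doobIncrement D f k | coordSigma Z m (k : ℕ)] =ᵐ[μ] 0 := by
    have h1 := condExp_sub (μ := μ) (f := μ[f | coordSigma Z m ((k : ℕ) + 1)])
      (g := μ[f | coordSigma Z m (k : ℕ)]) integrable_condExp integrable_condExp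
      (coordSigma Z m (k : ℕ))
    have h2 := condExp_condExp_of_le (μ := μ) (f := f)
      (coordSigma_mono (Z := Z) (m := m) (Nat.le_succ (k : ℕ))) (coordSigma_le _)
    have h3 := condExp_of_stronglyMeasurable (μ := μ) (coordSigma_le (Z := Z) (m := m) (k : ℕ))
      (stronglyMeasurable_condExp (f := f)) integrable_condExp
    filter_upwards [h1, h2] with x hx1 hx2
    refine hx1.trans ?_
    rw [Pi.sub_apply, hx2, h3]
    simp
  filter_upwards [hzero, condExp_coordSigma_ae_eq D (k : ℕ) hint] with x hx0 hx
  rw [hx0, Pi.zero_apply] at hx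
  refine Eq.trans ?_ hx.symm
  refine integral_congr_ae (ae_of_all _ fun y => ?_)
  refine eq_of_stronglyMeasurable_coordSigma (stronglyMeasurable_doobIncrement D f k)
    fun i hi => ?_
  rcases eq_or_ne i k with rfl | hik
  · simp [Set.piecewise]
  · have hlt : i < k := lt_of_le_of_ne (Nat.lt_succ_iff.1 hi) hik
    simp [Set.piecewise, hlt, hik]

lemma doobIncrement_update_sub_le (D : Measure Z) [IsProbabilityMeasure D]
    {f : (Fin m → Z) → ℝ} {c : ℝ} (hc0 : 0 ≤ c) (k : Fin m)
    (hc : ∀ x z, f x - f (Function.update x k z) ≤ c) :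
    ∀ᵐ x ∂(Measure.pi fun _ => D), ∀ᵐ y' ∂(Measure.pi fun _ => D),
      ∀ᵐ y ∂(Measure.pi fun _ => D),
        doobIncrement D f k (Function.update x k (y k))
          - doobIncrement D f k (Function.update x k (y' k)) ≤ c := by
  set μ : Measure (Fin m → Z) := Measure.pi fun _ => D with hμ
  by_cases hf : Integrable f μ
  swap
  · refine ae_of_all _ fun x => ae_of_all _ fun y => ae_of_all _ fun y' => ?_
    simp [doobIncrement, ← hμ, condExp_of_not_integrable hf, hc0]
  have hmp := measurePreserving_piecewise D {i : Fin m | (i : ℕ) < (k : ℕ) + 1}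
  have hP : ∀ᵐ x ∂μ, ∀ᵐ y ∂μ,
      (Integrable (fun w => f ({i : Fin m | (i : ℕ) < (k : ℕ) + 1}.piecewise
          (Function.update x k (y k)) w)) μ) ∧
      (μ[f | coordSigma Z m ((k : ℕ) + 1)]) (Function.update x k (y k))
        = ∫ w, f ({i : Fin m | (i : ℕ) < (k : ℕ) + 1}.piecewise
          (Function.update x k (y k)) w) ∂μ := by
    refine Measure.ae_ae_of_ae_prod ((measurePreserving_update D k).quasiMeasurePreserving.ae
      (p := fun x => (Integrable (fun w => f ({i : Fin m | (i : ℕ) < (k : ℕ) + 1}.piecewise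
          x w)) μ) ∧ (μ[f | coordSigma Z m ((k : ℕ) + 1)]) x
        = ∫ w, f ({i : Fin m | (i : ℕ) < (k : ℕ) + 1}.piecewise x w) ∂μ) ?_)
    filter_upwards [(hmp.integrable_comp_of_integrable hf).prod_right_ae,
      condExp_coordSigma_ae_eq D ((k : ℕ) + 1) hf] with x h1 h2 using ⟨h1, h2⟩
  filter_upwards [hP] with x hx
  filter_upwards [hx] with y' hy'
  filter_upwards [hx] with y hy
  simp only [doobIncrement, Pi.sub_apply, condExp_coordSigma_update]
  rw [sub_sub_sub_cancel_right, hy.2, hy'.2, ← integral_sub hy.1 hy'.1]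
  have hle : ∀ w, f ({i : Fin m | (i : ℕ) < (k : ℕ) + 1}.piecewise
        (Function.update x k (y k)) w) - f ({i : Fin m | (i : ℕ) < (k : ℕ) + 1}.piecewise
        (Function.update x k (y' k)) w) ≤ c := by
    intro w
    convert hc _ (y' k) using 3
    ext i
    rcases eq_or_ne i k with rfl | hik
    · simp [Set.piecewise]
    · simp [Set.piecewise, hik]
  calc _ ≤ ∫ _, c ∂μ := integral_mono (hy.1.sub hy'.1) (integrable_const c) hle
    _ = c := by simp

/-- The Azuma–Hoeffding bound for increments of possibly different Doob martingales. -/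
lemma integral_exp_sum_doobIncrement_le (D : Measure Z) [IsProbabilityMeasure D]
    {f : Fin m → (Fin m → Z) → ℝ} {R : ℝ}
    (hR : ∀ k x, |f k x| ≤ R) {c : ℝ} (hc0 : 0 ≤ c)
    (hc : ∀ k x z, f k x - f k (Function.update x k z) ≤ c) (t : ℝ) :
    ∫ x, Real.exp (t * ∑ k, doobIncrement D (f k) k x) ∂(Measure.pi fun _ => D)
      ≤ Real.exp (m * (t ^ 2 * c ^ 2 / 8)) := by
  set μ : Measure (Fin m → Z) := Measure.pi fun _ => D with hμ
  set X : Fin m → (Fin m → Z) → ℝ := fun k => doobIncrement D (f k) k with hX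
  have hXm : ∀ k, StronglyMeasurable (X k) := fun k =>
    (stronglyMeasurable_doobIncrement D (f k) k).mono (coordSigma_le _)
  have hexp : ∀ s : Finset (Fin m), Integrable (fun x => Real.exp (t * ∑ k ∈ s, X k x)) μ := by
    intro s
    have hm : AEMeasurable (fun x => ∑ k ∈ s, X k x) μ :=
      (Finset.measurable_fun_sum s fun k _ => (hXm k).measurable).aemeasurable
    refine integrable_exp_mul_of_mem_Icc (a := -(∑ _k ∈ s, 2 * (R : ℝ)))
      (b := ∑ _k ∈ s, 2 * (R : ℝ)) hm ?_
    filter_upwards [ae_all_iff.2 fun k => abs_doobIncrement_le D (hR k) k] with x hx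
    rw [Set.mem_Icc, ← abs_le]
    exact (Finset.abs_sum_le_sum_abs _ _).trans (Finset.sum_le_sum fun k _ => hx k)
  suffices H : ∀ n : ℕ, n ≤ m →
      ∫ x, Real.exp (t * ∑ k ∈ Finset.univ.filter (fun k : Fin m => (k : ℕ) < n), X k x) ∂μ
        ≤ Real.exp (n * (t ^ 2 * c ^ 2 / 8)) by
    simpa using H m le_rfl
  intro n
  induction n with
  | zero => intro _; simp
  | succ n ih =>
    intro hn
    set k : Fin m := ⟨n, hn⟩ with hk
    set s := Finset.univ.filter (fun k : Fin m => (k : ℕ) < n) with hs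
    have hins : Finset.univ.filter (fun k : Fin m => (k : ℕ) < n + 1) = insert k s := by
      ext i
      simp [hs, hk, Fin.ext_iff, le_iff_eq_or_lt]
    have hks : k ∉ s := by simp [hs, hk]
    have hpast : ∀ x z, ∑ i ∈ s, X i (Function.update x k z) = ∑ i ∈ s, X i x := by
      intro x z
      refine Finset.sum_congr rfl fun i hi => ?_
      have hin : (i : ℕ) < n := (Finset.mem_filter.1 hi).2
      refine eq_of_stronglyMeasurable_coordSigma (stronglyMeasurable_doobIncrement D (f i) i)
        fun j hj => Function.update_of_ne ?_ _ _
      rintro rfl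
      simp only [hk] at hj
      omega
    have hmp := measurePreserving_update D k
    have hint := hexp (insert k s)
    have hint' := hmp.integrable_comp_of_integrable hint
    have hbd : ∀ᵐ x ∂μ, ∀ᵐ y ∂μ, |X k (Function.update x k (y k))| ≤ 2 * R :=
      Measure.ae_ae_of_ae_prod
        (hmp.quasiMeasurePreserving.ae (abs_doobIncrement_le D (hR k) k))
    rw [hins]
    calc ∫ x, Real.exp (t * ∑ i ∈ insert k s, X i x) ∂μ
        = ∫ x, ∫ y, Real.exp (t * ∑ i ∈ insert k s, X i (Function.update x k (y k))) ∂μ ∂μ := by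
          conv_lhs => rw [hμ, ← hmp.map_eq]
          rw [integral_map hmp.measurable.aemeasurable
            (by rw [hmp.map_eq]; exact hint.aestronglyMeasurable)]
          exact integral_prod _ hint'
      _ ≤ ∫ x, Real.exp (t * ∑ i ∈ s, X i x) * Real.exp (t ^ 2 * c ^ 2 / 8) ∂μ := by
          refine integral_mono_ae hint'.integral_prod_left ((hexp s).mul_const _) ?_
          filter_upwards [integral_doobIncrement_update D (f k) k,
            doobIncrement_update_sub_le D hc0 k (hc k), hbd] with x h0 hsub hb
          simp only [Finset.sum_insert hks, hpast, mul_add, Real.exp_add]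
          simp only [mul_comm (Real.exp (t * X k _)), integral_const_mul]
          refine mul_le_mul_of_nonneg_left ?_ (Real.exp_pos _).le
          refine integral_exp_mul_le_of_sub_le ?_ hb h0 hsub t
          exact ((hXm k).measurable.comp
            (hmp.measurable.comp measurable_prodMk_left)).aemeasurable
      _ = (∫ x, Real.exp (t * ∑ i ∈ s, X i x) ∂μ) * Real.exp (t ^ 2 * c ^ 2 / 8) :=
          integral_mul_const _ _
      _ ≤ Real.exp (n * (t ^ 2 * c ^ 2 / 8)) * Real.exp (t ^ 2 * c ^ 2 / 8) :=
          mul_le_mul_of_nonneg_right (ih (by omega)) (Real.exp_pos _).le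
      _ = Real.exp ((n + 1 : ℕ) * (t ^ 2 * c ^ 2 / 8)) := by
          rw [← Real.exp_add]
          push_cast
          ring_nf

lemma mem_goodEvent_update_iff (β : Z → Z → ℝ) (D : Measure Z) (η : ℝ) (k : Fin m)
    (x : Fin m → Z) (z : Z) :
    Function.update x k z ∈ goodEvent β D η k ↔ x ∈ goodEvent β D η k := by
  simp only [goodEvent, Set.mem_ofPred_eq]
  refine forall_congr' fun z' => ?_
  rw [Finset.sum_congr rfl fun j hj => by
    rw [Function.update_of_ne (Finset.ne_of_mem_erase hj)]]

/-- Under locally elastic stability, replacing the `k`-th sample point changes the total loss,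
restricted to the good event, by at most `2 * B + 2 * η + Ml`, where `B` bounds the population
means of `β`. -/
lemma totalLoss_mul_indicator_sub_le {F : Type*} {l : F → Z → ℝ} {Ml : ℝ}
    (hl0 : ∀ f z, 0 ≤ l f z) (hlM : ∀ f z, l f z ≤ Ml)
    {A : (n : ℕ) → (Fin n → Z) → F} {β : Z → Z → ℝ}
    (hLES : ∀ (n : ℕ) (S : Fin (n + 1) → Z) (i : Fin (n + 1)) (z : Z),
      |l (A (n + 1) S) z - l (A n (i.removeNth S)) z| ≤ β (S i) z / (n + 1))
    {D : Measure Z} {B η : ℝ} (hB : ∀ z', ∫ z, β z' z ∂D ≤ B) (h0 : 0 ≤ 2 * B + 2 * η + Ml)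
    (k : Fin m) (x : Fin m → Z) (z : Z) :
    totalLoss l A m x * (goodEvent β D η k).indicator (fun _ => (1 : ℝ)) x
      - totalLoss l A m (Function.update x k z) *
        (goodEvent β D η k).indicator (fun _ => (1 : ℝ)) (Function.update x k z)
      ≤ 2 * B + 2 * η + Ml := by
  by_cases hx : x ∈ goodEvent β D η k
  swap
  · have hx' := (mem_goodEvent_update_iff β D η k x z).not.2 hx
    simpa [hx, hx'] using h0
  have hx' := (mem_goodEvent_update_iff β D η k x z).2 hx
  rw [Set.indicator_of_mem hx, Set.indicator_of_mem hx', mul_one, mul_one]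
  obtain _ | n := m
  · exact k.elim0
  set x' := Function.update x k z with hx'_def
  have hremove : k.removeNth x' = k.removeNth x := by
    ext1 j
    simp [hx'_def, Fin.removeNth]
  have hterm : ∀ j ∈ Finset.univ.erase k,
      l (A (n + 1) x) (x j) - l (A (n + 1) x') (x' j)
        ≤ (β (x k) (x j) + β z (x j)) / (n + 1 : ℕ) := by
    intro j hj
    have h1 := (abs_le.1 (hLES n x k (x j))).2
    have h2 := (abs_le.1 (hLES n x' k (x j))).1
    rw [hremove, hx'_def, Function.update_self, ← hx'_def] at h2
    rw [hx'_def, Function.update_of_ne (Finset.ne_of_mem_erase hj), ← hx'_def, add_div]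
    push_cast
    linarith
  have hgood : ∀ z', (∑ j ∈ Finset.univ.erase k, β z' (x j)) / (n + 1 : ℕ) ≤ B + η := by
    intro z'
    have := (abs_le.1 (hx z')).2
    linarith [hB z']
  have hk : l (A (n + 1) x) (x k) - l (A (n + 1) x') (x' k) ≤ Ml := by
    linarith [hlM (A (n + 1) x) (x k), hl0 (A (n + 1) x') (x' k)]
  have hsum := Finset.sum_le_sum hterm
  rw [← Finset.sum_div, Finset.sum_add_distrib, add_div] at hsum
  rw [totalLoss, totalLoss, ← Finset.sum_sub_distrib,
    ← Finset.add_sum_erase _ _ (Finset.mem_univ k)]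
  linarith [hgood (x k), hgood z]

end Aux

/-- Lemma A.5 of the paper. With
`M̃ = 2·sup_{z'} E_{z∼D} β(z',z) + 2η + Ml`, for any `λ ∈ ℝ`,
`E[exp(2λ·∑_{k=1}^{m} D_k^{(1)})] ≤ exp((1/2)mλ²M̃²)`. -/
theorem mgf_bound_of_good_event_martingale
    (d : ℕ) (Z : Set (EuclideanSpace ℝ (Fin d)))
    (hZbounded : Bornology.IsBounded Z) (hZmeas : MeasurableSet Z)
    (D : Measure Z) [IsProbabilityMeasure D]
    (F : Type*) (l : F → Z → ℝ) (Ml : ℝ)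
    (hl0 : ∀ f z, 0 ≤ l f z) (hlM : ∀ f z, l f z ≤ Ml)
    (A : (n : ℕ) → (Fin n → Z) → F)
    (β : Z → Z → ℝ) (Mβ L : ℝ)
    (hβbdd : ∀ z' z, |β z' z| ≤ Mβ)
    (hβlip : ∀ z : Z, LipschitzWith (Real.toNNReal L) fun z' => β z' z)
    (hLES : ∀ (n : ℕ) (S : Fin (n + 1) → Z) (i : Fin (n + 1)) (z : Z),
      |l (A (n + 1) S) z - l (A n (i.removeNth S)) z| ≤ β (S i) z / (n + 1))
    (m : ℕ) (η : ℝ) (hη : 0 < η) (lam : ℝ) :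
    (∫ ω, Real.exp (2 * lam *
            ∑ k : Fin m, Done l A β D η (Measure.pi fun _ : Fin m => D) k ω)
        ∂(Measure.pi fun _ : Fin m => D))
      ≤ Real.exp (1 / 2 * m * lam ^ 2 *
          (2 * (⨆ z' : Z, ∫ z, β z' z ∂D) + 2 * η + Ml) ^ 2) := by
  obtain ⟨z₀⟩ : Nonempty Z := nonempty_of_isProbabilityMeasure D
  have hβ0 : ∀ z' z, 0 ≤ β z' z := fun z' z => by
    simpa using (abs_nonneg _).trans (hLES 0 (fun _ => z') 0 z)
  have hMl : 0 ≤ Ml := (hl0 (A 0 Fin.elim0) z₀).trans (hlM _ _)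
  have hbdd : BddAbove (Set.range fun z' : Z => ∫ z, β z' z ∂D) := by
    refine ⟨Mβ, Set.forall_mem_range.2 fun z' => (le_abs_self _).trans ?_⟩
    simpa using norm_integral_le_of_norm_le_const (μ := D) (f := β z') (ae_of_all _ (hβbdd z'))
  have hB := le_ciSup hbdd
  set B := ⨆ z' : Z, ∫ z, β z' z ∂D
  have hB0 : 0 ≤ B := (integral_nonneg (hβ0 z₀)).trans (hB z₀)
  have h0 : 0 ≤ 2 * B + 2 * η + Ml := by positivity
  have hR : ∀ (k : Fin m) (x : Fin m → Z), |totalLoss l A m x *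
      (goodEvent β D η k).indicator (fun _ => (1 : ℝ)) x| ≤ m * Ml := by
    intro k x
    have h1 : |totalLoss l A m x| ≤ m * Ml := by
      rw [totalLoss, abs_of_nonneg (Finset.sum_nonneg fun j _ => hl0 _ _)]
      simpa using Finset.sum_le_sum fun j (_ : j ∈ Finset.univ) => hlM (A m x) (x j)
    by_cases hx : x ∈ goodEvent β D η k
    · simpa [hx] using h1
    · simpa [hx] using (abs_nonneg _).trans h1
  refine (integral_exp_sum_doobIncrement_le D hR h0
    (totalLoss_mul_indicator_sub_le hl0 hlM hLES hB h0) (2 * lam)).trans (le_of_eq ?_)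
  congr 1
  ring

end
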